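/- Let a ∈ (1/2, 1) and set α = exp(−2πi·a) (so α ∉ {1, −1}). Then there exist matrices A₀, A₁, A₄, A_∞ ∈ GL₄(ℂ) such that: (i) A₀·A₁·A₄·A_∞ = I; (ii) A₀ and A₄ are each conjugate in GL₄(ℂ) to diag(J₂(1), 1, 1); (iii) A₁ is conjugate to the diagonal matrix diag(α, α⁻¹, 1, 1); (iv) A_∞ is conjugate to diag(J₂(−1), J₂(−1)); (v) the tuple (A₀, A₁, A₄, A_∞) is irreducible; (vi) there exists an invertible matrix S ∈ GL₄(ℂ) with Sᵀ = −S and AᵀSA = S for each A ∈ {A₀, A₁, A₄, A_∞}. -/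

import Mathlib

/-!
Statement 5: existence of the monodromy tuple of the rigid local system 𝒫₁₃
(case α ≠ −1, β = −1), with symplectic monodromy group.
-/

open Matrix

/-- Two square matrices are conjugate (by an invertible matrix). -/
def MatConj {n : ℕ} (A B : Matrix (Fin n) (Fin n) ℂ) : Prop :=
  ∃ C : Matrix (Fin n) (Fin n) ℂ, IsUnit C ∧ C * A * C⁻¹ = B

/-- A set of matrices acts irreducibly on ℂⁿ: the only common invariant
subspaces are `⊥` and `⊤`. -/
def MatIrred {n : ℕ} (s : Set (Matrix (Fin n) (Fin n) ℂ)) : Prop :=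
  ∀ W : Submodule ℂ (Fin n → ℂ), (∀ A ∈ s, ∀ v ∈ W, A.mulVec v ∈ W) → W = ⊥ ∨ W = ⊤

theorem matConj_of_mul_eq {n : ℕ} {A B P : Matrix (Fin n) (Fin n) ℂ} (hP : P.det ≠ 0)
    (h : A * P = P * B) : MatConj A B := by
  have hu : IsUnit P.det := isUnit_iff_ne_zero.mpr hP
  refine ⟨P⁻¹, (isUnit_nonsing_inv_iff).mpr ((isUnit_iff_isUnit_det P).mpr hu), ?_⟩
  rw [nonsing_inv_nonsing_inv P hu, mul_assoc, h, ← mul_assoc, nonsing_inv_mul P hu, one_mul]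

namespace RigidTuple

/-- The alternating form preserved by the tuple. -/
def form : Matrix (Fin 4) (Fin 4) ℂ :=
  !![0, 1, 0, 0; -1, 0, 0, 0; 0, 0, 0, 4; 0, 0, -4, 0]

/-- The transvection along `(1, b, 1, 0)`. -/
def A0 (b : ℂ) : Matrix (Fin 4) (Fin 4) ℂ :=
  !![1 - b, 1, 0, 4; -b ^ 2, 1 + b, 0, 4 * b; -b, 1, 1, 4; 0, 0, 0, 1]

/-- The semisimple element `diag(α, α⁻¹, 1, 1)`. -/
noncomputable def A1 (α : ℂ) : Matrix (Fin 4) (Fin 4) ℂ :=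
  !![α, 0, 0, 0; 0, α⁻¹, 0, 0; 0, 0, 1, 0; 0, 0, 0, 1]

/-- The transvection along `(c, d, 0, 1)` with parameter `q`. -/
def A4 (c d q : ℂ) : Matrix (Fin 4) (Fin 4) ℂ :=
  !![1 - q * c * d, q * c ^ 2, -4 * q * c, 0; -q * d ^ 2, 1 + q * c * d, -4 * q * d, 0;
    0, 0, 1, 0; -q * d, q * c, -4 * q, 1]

/-- The inverse of `A0 * A1 * A4` for the parameters used below. -/
noncomputable def Ainf (α b c d q : ℂ) : Matrix (Fin 4) (Fin 4) ℂ :=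
  !![α⁻¹ + b - q * c * (1 + α⁻¹), -1 - q * c * (α - 1), 4 * q * c, -4;
    b ^ 2 - q * d * (1 + α⁻¹), α - b - q * d * (α - 1), 4 * q * d, -4 * b;
    b, -1, 1, -4;
    b - q * (1 + α⁻¹), -1 - q * (α - 1), 4 * q, -3]

theorem A0_preserves (b : ℂ) : (A0 b)ᵀ * form * A0 b = form := by
  ext i j
  fin_cases i <;> fin_cases j <;>
    simp [A0, form, Matrix.mul_apply, Fin.sum_univ_four] <;> ring

theorem A1_preserves {α : ℂ} (h0 : α ≠ 0) : (A1 α)ᵀ * form * A1 α = form := by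
  ext i j
  fin_cases i <;> fin_cases j <;>
    simp [A1, form, Matrix.mul_apply, Fin.sum_univ_four, h0]

theorem A4_preserves (c d q : ℂ) : (A4 c d q)ᵀ * form * A4 c d q = form := by
  ext i j
  fin_cases i <;> fin_cases j <;>
    simp [A4, form, Matrix.mul_apply, Fin.sum_univ_four] <;> ring

theorem det_form : form.det = 16 := by
  simp [form, Matrix.det_succ_row_zero, Fin.sum_univ_succ, Fin.succAbove]
  norm_num

theorem preserves_of_mul_eq_one {n : ℕ} {S M N : Matrix (Fin n) (Fin n) ℂ}
    (hM : Mᵀ * S * M = S) (h : M * N = 1) : Nᵀ * S * N = S := by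
  have ht : Nᵀ * Mᵀ = 1 := by rw [← transpose_mul, h, transpose_one]
  calc Nᵀ * S * N = Nᵀ * (Mᵀ * S * M) * N := by rw [hM]
    _ = (Nᵀ * Mᵀ) * S * (M * N) := by simp only [mul_assoc]
    _ = S := by rw [ht, h, one_mul, mul_one]

theorem preserves_mul {n : ℕ} {S M N : Matrix (Fin n) (Fin n) ℂ}
    (hM : Mᵀ * S * M = S) (hN : Nᵀ * S * N = S) : (M * N)ᵀ * S * (M * N) = S := by
  calc (M * N)ᵀ * S * (M * N) = Nᵀ * (Mᵀ * S * M) * N := by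
        simp only [transpose_mul, mul_assoc]
    _ = S := by rw [hM, hN]

theorem isUnit_of_preserves {n : ℕ} {S M : Matrix (Fin n) (Fin n) ℂ} (hS : IsUnit S)
    (hM : Mᵀ * S * M = S) : IsUnit M := by
  rw [isUnit_iff_isUnit_det] at hS ⊢
  rw [← hM, det_mul] at hS
  exact isUnit_of_mul_isUnit_right hS

theorem A0_conj (b : ℂ) :
    MatConj (A0 b) !![1, 1, 0, 0; 0, 1, 0, 0; 0, 0, 1, 0; 0, 0, 0, 1] := by
  refine matConj_of_mul_eq
    (P := !![1, 0, 0, 0; b, 1, 0, -4; 1, 0, 1, 0; 0, 0, 0, 1]) ?_ ?_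
  · simp [Matrix.det_succ_row_zero, Fin.sum_univ_succ, Fin.succAbove]
  · ext i j
    fin_cases i <;> fin_cases j <;>
      simp [A0, Matrix.mul_apply, Fin.sum_univ_four] <;> ring

theorem A4_conj {c q : ℂ} (d : ℂ) (hc : c ≠ 0) (hq : q ≠ 0) :
    MatConj (A4 c d q) !![1, 1, 0, 0; 0, 1, 0, 0; 0, 0, 1, 0; 0, 0, 0, 1] := by
  refine matConj_of_mul_eq
    (P := !![-4 * q * c, 0, 0, 0; -4 * q * d, 0, 0, 4; 0, 1, 0, c; -4 * q, 0, 1, 0]) ?_ ?_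
  · simp [Matrix.det_succ_row_zero, Fin.sum_univ_succ, Fin.succAbove, hc, hq]
  · ext i j
    fin_cases i <;> fin_cases j <;>
      simp [A4, Matrix.mul_apply, Fin.sum_univ_four] <;> ring

theorem mul_eq_one {α b c d q : ℂ} (h0 : α ≠ 0) (h1 : α - 1 ≠ 0)
    (hb : b = (α + 1) / (α - 1)) (hc : c = (α - 1) / α) (hd : d = -(α + 1))
    (hq : q = -α / (α - 1) ^ 2) :
    A0 b * A1 α * A4 c d q * Ainf α b c d q = 1 := by
  subst hb hc hd hq
  ext i j
  fin_cases i <;> fin_cases j <;>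
    simp [A0, A1, A4, Ainf, Matrix.mul_apply, Fin.sum_univ_four] <;> field_simp <;> ring

theorem Ainf_conj {α b c d q : ℂ} (h0 : α ≠ 0) (h1 : α - 1 ≠ 0) (h2 : α + 1 ≠ 0)
    (hb : b = (α + 1) / (α - 1)) (hc : c = (α - 1) / α) (hd : d = -(α + 1))
    (hq : q = -α / (α - 1) ^ 2) :
    MatConj (Ainf α b c d q) !![-1, 1, 0, 0; 0, -1, 0, 0; 0, 0, -1, 1; 0, 0, 0, -1] := by
  refine matConj_of_mul_eq
    (P := !![-4, 0, 4 * q * c, 0; -4 * b, 0, 4 * q * d, 0; -4, 0, 2, 1; -2, 1, 4 * q, 0]) ?_ ?_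
  · have : (!![-4, 0, 4 * q * c, 0; -4 * b, 0, 4 * q * d, 0; -4, 0, 2, 1;
        -2, 1, 4 * q, 0] : Matrix (Fin 4) (Fin 4) ℂ).det = -16 * ((α + 1) / (α - 1)) ^ 2 := by
      subst hb hc hd hq
      simp [Matrix.det_succ_row_zero, Fin.sum_univ_succ, Fin.succAbove]
      field_simp
      ring
    rw [this]
    simp [h1, h2]
  · subst hb hc hd hq
    ext i j
    fin_cases i <;> fin_cases j <;>
      simp [Ainf, Matrix.mul_apply, Fin.sum_univ_four] <;> field_simp <;> ring

section Irreducible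

variable {W : Submodule ℂ (Fin 4 → ℂ)}

theorem eq_top_of_single_mem (h : ∀ i, (Pi.single i 1 : Fin 4 → ℂ) ∈ W) : W = ⊤ := by
  rw [eq_top_iff, ← (Pi.basisFun ℂ (Fin 4)).span_eq, Submodule.span_le]
  rintro _ ⟨i, rfl⟩
  simpa using h i

theorem single_zero_mem {α : ℂ} (h0 : α ≠ 0) (h1 : α - 1 ≠ 0) (h2 : α + 1 ≠ 0)
    (hW : ∀ v ∈ W, A1 α *ᵥ v ∈ W) {x : Fin 4 → ℂ} (hx : x ∈ W) (hx0 : x 0 ≠ 0) :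
    (Pi.single 0 1 : Fin 4 → ℂ) ∈ W := by
  have hy := W.sub_mem (hW _ hx) hx
  have hz := W.sub_mem (hW _ hy) (W.smul_mem α⁻¹ hy)
  have hne : (α - 1) * (α + 1) * (α - 1) * α⁻¹ * x 0 ≠ 0 := by simp [h0, h1, h2, hx0]
  rw [← W.smul_mem_iff hne]
  convert hz using 1
  ext i
  fin_cases i <;> simp [A1, dotProduct, Fin.sum_univ_four, vecHead, vecTail] <;>
    field_simp <;> ring

theorem single_one_mem {α : ℂ} (h0 : α ≠ 0) (h1 : α - 1 ≠ 0) (h2 : α + 1 ≠ 0)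
    (hW : ∀ v ∈ W, A1 α *ᵥ v ∈ W) {x : Fin 4 → ℂ} (hx : x ∈ W) (hx1 : x 1 ≠ 0) :
    (Pi.single 1 1 : Fin 4 → ℂ) ∈ W := by
  have hy := W.sub_mem (hW _ hx) hx
  have hz := W.sub_mem (hW _ hy) (W.smul_mem α hy)
  have hne : (α - 1) * (α + 1) * (α - 1) * (α⁻¹) ^ 2 * x 1 ≠ 0 := by simp [h0, h1, h2, hx1]
  rw [← W.smul_mem_iff hne]
  convert hz using 1
  ext i
  fin_cases i <;> simp [A1, dotProduct, Fin.sum_univ_four, vecHead, vecTail] <;>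
    field_simp <;> ring

theorem A0_direction_mem {b : ℂ} (hW : ∀ v ∈ W, A0 b *ᵥ v ∈ W) {x : Fin 4 → ℂ} (hx : x ∈ W)
    (hne : x 1 - b * x 0 + 4 * x 3 ≠ 0) : ![1, b, 1, 0] ∈ W := by
  rw [← W.smul_mem_iff hne]
  convert W.sub_mem (hW _ hx) hx using 1
  ext i
  fin_cases i <;> simp [A0, dotProduct, Fin.sum_univ_four] <;> ring

theorem A4_direction_mem {c d q : ℂ} (hq : q ≠ 0) (hW : ∀ v ∈ W, A4 c d q *ᵥ v ∈ W)
    {x : Fin 4 → ℂ} (hx : x ∈ W) (hne : c * x 1 - d * x 0 - 4 * x 2 ≠ 0) :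
    ![c, d, 0, 1] ∈ W := by
  rw [← W.smul_mem_iff (mul_ne_zero hq hne)]
  convert W.sub_mem (hW _ hx) hx using 1
  ext i
  fin_cases i <;> simp [A4, dotProduct, Fin.sum_univ_four] <;> ring

theorem eq_bot_or_eq_top {α b c d q : ℂ} (h0 : α ≠ 0) (h1 : α - 1 ≠ 0) (h2 : α + 1 ≠ 0)
    (hb : b ≠ 0) (hd : d ≠ 0) (hq : q ≠ 0)
    (hW0 : ∀ v ∈ W, A0 b *ᵥ v ∈ W) (hW1 : ∀ v ∈ W, A1 α *ᵥ v ∈ W)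
    (hW4 : ∀ v ∈ W, A4 c d q *ᵥ v ∈ W) : W = ⊥ ∨ W = ⊤ := by
  have top_of_zero (he0 : (Pi.single 0 1 : Fin 4 → ℂ) ∈ W) : W = ⊤ := by
    have hv : ![1, b, 1, 0] ∈ W := A0_direction_mem hW0 he0 (by simpa using hb)
    have hw : ![c, d, 0, 1] ∈ W := A4_direction_mem hq hW4 he0 (by simpa using hd)
    have he1 : (Pi.single 1 1 : Fin 4 → ℂ) ∈ W :=
      single_one_mem h0 h1 h2 hW1 hv (by simpa using hb)
    have he2 : (Pi.single 2 1 : Fin 4 → ℂ) ∈ W := by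
      convert W.sub_mem (W.sub_mem hv he0) (W.smul_mem b he1) using 1
      ext i; fin_cases i <;> simp [vecHead, vecTail]
    have he3 : (Pi.single 3 1 : Fin 4 → ℂ) ∈ W := by
      convert W.sub_mem (W.sub_mem hw (W.smul_mem c he0)) (W.smul_mem d he1) using 1
      ext i; fin_cases i <;> simp [vecHead, vecTail]
    apply eq_top_of_single_mem
    intro i
    fin_cases i <;> assumption
  have top_of_one (he1 : (Pi.single 1 1 : Fin 4 → ℂ) ∈ W) : W = ⊤ :=
    top_of_zero <| single_zero_mem h0 h1 h2 hW1
      (A0_direction_mem hW0 he1 (by simp)) (by simp)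
  refine or_iff_not_imp_right.mpr fun htop => (Submodule.eq_bot_iff W).mpr fun x hx => ?_
  have hx0 : x 0 = 0 := by_contra fun h => htop (top_of_zero (single_zero_mem h0 h1 h2 hW1 hx h))
  have hx1 : x 1 = 0 := by_contra fun h => htop (top_of_one (single_one_mem h0 h1 h2 hW1 hx h))
  have hx3 : x 3 = 0 := by_contra fun h => htop <| top_of_zero <| single_zero_mem h0 h1 h2 hW1
    (A0_direction_mem hW0 hx (by simpa [hx0, hx1] using h)) (by simp)
  have hx2 : x 2 = 0 := by_contra fun h => htop <| top_of_one <| single_one_mem h0 h1 h2 hW1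
    (A4_direction_mem hq hW4 hx (by simpa [hx0, hx1] using h)) (by simpa using hd)
  ext i
  fin_cases i <;> assumption

end Irreducible

end RigidTuple

theorem exp_sq_ne_one {a : ℝ} (ha : a ∈ Set.Ioo (1 / 2 : ℝ) 1) :
    Complex.exp (-2 * Real.pi * Complex.I * a) ^ 2 ≠ 1 := by
  rw [← Complex.exp_nat_mul, Ne, Complex.exp_eq_one_iff]
  rintro ⟨n, hn⟩
  have h : (2 * Real.pi * Complex.I) * (-2 * a) = (2 * Real.pi * Complex.I) * n := by
    linear_combination hn
  have h' : ((-2 * a : ℝ) : ℂ) = ((n : ℝ) : ℂ) := by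
    push_cast
    exact mul_left_cancel₀ Complex.two_pi_I_ne_zero h
  have h'' : -2 * a = (n : ℝ) := Complex.ofReal_injective h'
  have hlo : (-2 : ℝ) < n := by linarith [ha.2]
  have hhi : (n : ℝ) < -1 := by linarith [ha.1]
  have hlo' : -2 < n := by exact_mod_cast hlo
  have hhi' : n < -1 := by exact_mod_cast hhi
  omega

open RigidTuple

theorem stmt_5 (a : ℝ) (ha : a ∈ Set.Ioo (1 / 2 : ℝ) 1) (α : ℂ)
    (hα : α = Complex.exp (-2 * Real.pi * Complex.I * a)) :
    ∃ A0 A1 A4 Ainf : Matrix (Fin 4) (Fin 4) ℂ,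
      IsUnit A0 ∧ IsUnit A1 ∧ IsUnit A4 ∧ IsUnit Ainf ∧
      A0 * A1 * A4 * Ainf = 1 ∧
      MatConj A0 !![1, 1, 0, 0; 0, 1, 0, 0; 0, 0, 1, 0; 0, 0, 0, 1] ∧
      MatConj A4 !![1, 1, 0, 0; 0, 1, 0, 0; 0, 0, 1, 0; 0, 0, 0, 1] ∧
      MatConj A1 !![α, 0, 0, 0; 0, α⁻¹, 0, 0; 0, 0, 1, 0; 0, 0, 0, 1] ∧
      MatConj Ainf !![-1, 1, 0, 0; 0, -1, 0, 0; 0, 0, -1, 1; 0, 0, 0, -1] ∧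
      MatIrred {A0, A1, A4, Ainf} ∧
      ∃ S : Matrix (Fin 4) (Fin 4) ℂ, IsUnit S ∧ Sᵀ = -S ∧
        ∀ A ∈ ({A0, A1, A4, Ainf} : Set (Matrix (Fin 4) (Fin 4) ℂ)), Aᵀ * S * A = S := by
  have h0 : α ≠ 0 := hα ▸ Complex.exp_ne_zero _
  have hsq : α ^ 2 ≠ 1 := hα ▸ exp_sq_ne_one ha
  have h1 : α - 1 ≠ 0 := fun h => hsq (by linear_combination (α + 1) * h)
  have h2 : α + 1 ≠ 0 := fun h => hsq (by linear_combination (α - 1) * h)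
  obtain ⟨b, hb⟩ : ∃ b, b = (α + 1) / (α - 1) := ⟨_, rfl⟩
  obtain ⟨c, hc⟩ : ∃ c, c = (α - 1) / α := ⟨_, rfl⟩
  obtain ⟨d, hd⟩ : ∃ d, d = -(α + 1) := ⟨_, rfl⟩
  obtain ⟨q, hq⟩ : ∃ q, q = -α / (α - 1) ^ 2 := ⟨_, rfl⟩
  have hb0 : b ≠ 0 := hb ▸ div_ne_zero h2 h1
  have hc0 : c ≠ 0 := hc ▸ div_ne_zero h1 h0
  have hd0 : d ≠ 0 := hd ▸ neg_ne_zero.mpr h2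
  have hq0 : q ≠ 0 := hq ▸ div_ne_zero (neg_ne_zero.mpr h0) (pow_ne_zero 2 h1)
  have hS : IsUnit form := by
    rw [isUnit_iff_isUnit_det, det_form]
    exact isUnit_iff_ne_zero.mpr (by norm_num)
  have hprod := mul_eq_one h0 h1 hb hc hd hq
  have p0 := A0_preserves b
  have p1 := A1_preserves h0
  have p4 := A4_preserves c d q
  have pinf := preserves_of_mul_eq_one (preserves_mul (preserves_mul p0 p1) p4) hprod
  refine ⟨A0 b, A1 α, A4 c d q, Ainf α b c d q, isUnit_of_preserves hS p0,
    isUnit_of_preserves hS p1, isUnit_of_preserves hS p4, isUnit_of_preserves hS pinf, hprod,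
    A0_conj b, A4_conj d hc0 hq0, ⟨1, isUnit_one, by simp [A1]⟩,
    Ainf_conj h0 h1 h2 hb hc hd hq, fun W hW => ?_, form, hS, ?_, ?_⟩
  · exact eq_bot_or_eq_top (c := c) h0 h1 h2 hb0 hd0 hq0 (hW _ (by simp)) (hW _ (by simp))
      (hW _ (by simp))
  · ext i j
    fin_cases i <;> fin_cases j <;> simp [form]
  · rintro A (rfl | rfl | rfl | rfl) <;> assumption
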